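/- arXiv:1708.00378 — 2 statements merged into one kernel-verified Lean document; each statement's English description precedes it below -/
import Mathlib

section
/- Let (X, Σ_X, ℬ) be a conditional measurable space and let 𝒜_X be an algebra of subsets of X with σ(𝒜_X) = Σ_X. Then the σ-algebra on Δ^ℬ(X) generated by the sets β^p_B(E) = {μ ∈ Δ^ℬ(X) : μ_B(E) ≥ p} with E ∈ 𝒜_X, p ∈ ℚ ∩ [0,1], B ∈ ℬ, coincides with the σ-algebra Σ_{ℬ(X)} generated by the sets β^p_B(A) with A ranging over all of Σ_X, p ∈ [0,1], B ∈ ℬ. -/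
open MeasureTheory

/-- A conditional probability system (CPS) on a conditional measurable space `(X, Σ_X, ℬ)`:
a family `μ = (μ_B)_{B ∈ ℬ}` of σ-additive probability measures on `(X, Σ_X)` such that
(A1) `μ_B(B) = 1` for all `B ∈ ℬ`, and (A3) `μ_B(A) · μ_C(B) = μ_C(A)` whenever `A ∈ Σ_X`,
`B, C ∈ ℬ` and `A ⊆ B ⊆ C`. -/
def IsCPS {X : Type*} [MeasurableSpace X] (ℬ : Set (Set X))
    (μ : ↥ℬ → ProbabilityMeasure X) : Prop :=
  (∀ B : ↥ℬ, μ B (B : Set X) = 1) ∧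
  ∀ (A : Set X) (B C : ↥ℬ), MeasurableSet A → A ⊆ (B : Set X) → (B : Set X) ⊆ (C : Set X) →
    (μ B A : ℝ) * (μ C (B : Set X) : ℝ) = (μ C A : ℝ)

/-- `Δ^ℬ(X)`, the set of conditional probability systems on `(X, Σ_X, ℬ)`. -/
def CPS (X : Type*) [MeasurableSpace X] (ℬ : Set (Set X)) : Type _ :=
  {μ : ↥ℬ → ProbabilityMeasure X // IsCPS ℬ μ}

/-- A real function with values in `[0, 1]` is measurable as soon as its superlevel sets at rational
levels in `[0, 1]` are. -/
theorem measurable_of_le_rat_of_mem_Icc {Ω : Type*} [MeasurableSpace Ω] {f : Ω → ℝ}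
    (hf : ∀ ω, f ω ∈ Set.Icc (0 : ℝ) 1)
    (h : ∀ q : ℚ, 0 ≤ q → q ≤ 1 → MeasurableSet {ω | (q : ℝ) ≤ f ω}) : Measurable f := by
  rw [Real.borelSpace.measurable_eq, Real.borel_eq_generateFrom_Ici_rat]
  refine measurable_generateFrom fun t ht => ?_
  obtain ⟨q, rfl⟩ := Set.mem_iUnion.mp ht
  rcases lt_or_ge q 0 with h0 | h0
  · convert MeasurableSet.univ
    refine Set.eq_univ_of_forall fun ω => ?_
    have hq : (q : ℝ) < 0 := by exact_mod_cast h0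
    exact hq.le.trans (hf ω).1
  rcases le_or_gt q 1 with h1 | h1
  · exact h q h0 h1
  · convert MeasurableSet.empty
    refine Set.eq_empty_of_forall_notMem fun ω hω => ?_
    have hq : (1 : ℝ) < q := by exact_mod_cast h1
    exact (hq.trans_le (Set.mem_Ici.mp hω)).not_ge (hf ω).2

/-- Let `(X, Σ_X, ℬ)` be a conditional measurable space (`ℬ` a countable
family of nonempty measurable sets) and let `𝒜` be an algebra of subsets of `X` with
`σ(𝒜) = Σ_X`.  Then the σ-algebra on `Δ^ℬ(X)` generated by the sets
`β^p_B(E) = {μ : μ_B(E) ≥ p}` with `E ∈ 𝒜`, `p ∈ ℚ ∩ [0,1]`, `B ∈ ℬ` coincides with the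
σ-algebra `Σ_{ℬ(X)}` generated by the sets `β^p_B(A)` with `A` ranging over all of `Σ_X`,
`p ∈ [0,1]`, `B ∈ ℬ`. -/
theorem generateFrom_algebra_rat_eq_cps_sigmaAlgebra
    {X : Type*} [mX : MeasurableSpace X] (ℬ : Set (Set X)) (𝒜 : Set (Set X))
    (hℬ_count : ℬ.Countable)
    (hℬ_mble : ∀ B ∈ ℬ, MeasurableSet B)
    (hℬ_ne : ∀ B ∈ ℬ, B.Nonempty)
    (h𝒜_univ : Set.univ ∈ 𝒜)
    (h𝒜_compl : ∀ A ∈ 𝒜, Aᶜ ∈ 𝒜)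
    (h𝒜_union : ∀ A ∈ 𝒜, ∀ B ∈ 𝒜, A ∪ B ∈ 𝒜)
    (h𝒜_gen : MeasurableSpace.generateFrom 𝒜 = mX) :
    MeasurableSpace.generateFrom
      {s : Set (CPS X ℬ) |
        ∃ E ∈ 𝒜, ∃ B : ↥ℬ, ∃ p : ℚ, 0 ≤ p ∧ p ≤ 1 ∧
          s = {μ : CPS X ℬ | (p : ℝ) ≤ (μ.1 B E : ℝ)}} =
    MeasurableSpace.generateFrom
      {s : Set (CPS X ℬ) |
        ∃ A : Set X, MeasurableSet A ∧ ∃ B : ↥ℬ, ∃ p : ℝ, p ∈ Set.Icc (0 : ℝ) 1 ∧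
          s = {μ : CPS X ℬ | p ≤ (μ.1 B A : ℝ)}} := by
  apply le_antisymm
  · refine MeasurableSpace.generateFrom_mono ?_
    rintro s ⟨E, hE, B, p, h0, h1, rfl⟩
    refine ⟨E, h𝒜_gen ▸ MeasurableSpace.measurableSet_generateFrom hE, B, p, ⟨?_, ?_⟩, rfl⟩
    · exact_mod_cast h0
    · exact_mod_cast h1
  · refine MeasurableSpace.generateFrom_le ?_
    rintro s ⟨A, hA, B, p, -, rfl⟩
    let m := MeasurableSpace.generateFrom
      {s : Set (CPS X ℬ) |
        ∃ E ∈ 𝒜, ∃ B : ↥ℬ, ∃ p : ℚ, 0 ≤ p ∧ p ≤ 1 ∧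
          s = {μ : CPS X ℬ | (p : ℝ) ≤ (μ.1 B E : ℝ)}}
    have hpi : IsPiSystem 𝒜 := fun s hs t ht _ => by
      simpa [Set.compl_union] using h𝒜_compl _ (h𝒜_union _ (h𝒜_compl s hs) _ (h𝒜_compl t ht))
    have hbasic : ∀ E ∈ 𝒜, Measurable fun μ : CPS X ℬ => (μ.1 B : Measure X) E := by
      intro E hE
      have hreal : Measurable fun μ : CPS X ℬ => (μ.1 B E : ℝ) :=
        measurable_of_le_rat_of_mem_Icc
          (fun μ => ⟨NNReal.coe_nonneg _, by exact_mod_cast (μ.1 B).apply_le_one E⟩)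
          fun q h0 h1 => MeasurableSpace.measurableSet_generateFrom ⟨E, hE, B, q, h0, h1, rfl⟩
      simpa using hreal.ennreal_ofReal
    have hmeas : Measurable fun μ : CPS X ℬ => (μ.1 B : Measure X) :=
      Measurable.measure_of_isPiSystem_of_isProbabilityMeasure h𝒜_gen.symm hpi hbasic
    have hA' : Measurable fun μ : CPS X ℬ => (μ.1 B A : ℝ) :=
      ((Measure.measurable_coe hA).comp hmeas).ennreal_toReal
    exact measurableSet_le measurable_const hA'
end

section
/- Let (X, Σ_X, ℬ) be a conditional measurable space, let (Y, Σ_Y) and (Y', Σ_{Y'}) be measurable spaces, and set Z := X × Y and Z' := X × Y' with the product σ-algebras and with conditioning events ℬ_Z := {B × Y : B ∈ ℬ} and ℬ_{Z'} := {B × Y' : B ∈ ℬ}. Let f : Z → Z' be measurable and preserve the X-coordinate, i.e., proj_X ∘ f = proj_X. Then the image-measure map with conditioning events f̂ : Δ^ℬ(Z) → Δ^ℬ(Z'), defined by f̂(μ)_{B×Y'}(E) := μ_{B×Y}(f⁻¹(E)) for every μ ∈ Δ^ℬ(Z), E ∈ Σ_{Z'}, B ∈ ℬ, is measurable with respect to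 the σ-algebras Σ_{ℬ(Z)} and Σ_{ℬ(Z')}. -/
open MeasureTheory

/-- A conditional probability system on the product space `Z = X × Y` with the conditioning
events `ℬ_Z = {B × Y : B ∈ ℬ}` coming from a conditional measurable space `(X, Σ_X, ℬ)`:
a family `μ = (μ_{B×Y})_{B ∈ ℬ}` of σ-additive probability measures on `Z` such that
(A1) `μ_{B×Y}(B × Y) = 1`, and (A3) `μ_{B×Y}(A) · μ_{C×Y}(B × Y) = μ_{C×Y}(A)` whenever
`A ∈ Σ_Z`, `B, C ∈ ℬ` and `A ⊆ B × Y ⊆ C × Y`. -/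
def IsProdCPS {X Y : Type*} [MeasurableSpace X] [MeasurableSpace Y] (ℬ : Set (Set X))
    (μ : ↥ℬ → ProbabilityMeasure (X × Y)) : Prop :=
  (∀ B : ↥ℬ, μ B ((B : Set X) ×ˢ (Set.univ : Set Y)) = 1) ∧
  ∀ (A : Set (X × Y)) (B C : ↥ℬ), MeasurableSet A →
    A ⊆ (B : Set X) ×ˢ (Set.univ : Set Y) →
    (B : Set X) ×ˢ (Set.univ : Set Y) ⊆ (C : Set X) ×ˢ (Set.univ : Set Y) →
    (μ B A : ℝ) * (μ C ((B : Set X) ×ˢ (Set.univ : Set Y)) : ℝ) = (μ C A : ℝ)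

/-- `Δ^ℬ(Z)` for `Z = X × Y`: the set of CPSs on `(Z, Σ_Z, ℬ_Z)`. -/
def ProdCPS (X Y : Type*) [MeasurableSpace X] [MeasurableSpace Y] (ℬ : Set (Set X)) :
    Type _ :=
  {μ : ↥ℬ → ProbabilityMeasure (X × Y) // IsProdCPS ℬ μ}

/-- The pushforward along a measurable, `X`-coordinate-preserving `f : X × Y → X × Y'` of a
CPS on `X × Y` is a CPS on `X × Y'` (this is the well-definedness of the image-measure map
with conditioning events). -/
lemma isProdCPS_map {X Y Y' : Type*} [MeasurableSpace X] [MeasurableSpace Y]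
    [MeasurableSpace Y'] (ℬ : Set (Set X))
    (hℬ_mble : ∀ B ∈ ℬ, MeasurableSet B) (hℬ_ne : ∀ B ∈ ℬ, B.Nonempty)
    (f : X × Y → X × Y') (hf : Measurable f) (hproj : ∀ z, (f z).1 = z.1)
    (μ : ↥ℬ → ProbabilityMeasure (X × Y)) (hμ : IsProdCPS ℬ μ) :
    IsProdCPS ℬ (fun B : ↥ℬ => (μ B).map hf.aemeasurable) := by
  have hpre : ∀ B : Set X,
      f ⁻¹' (B ×ˢ (Set.univ : Set Y')) = B ×ˢ (Set.univ : Set Y) := by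
    intro B
    ext z
    simp only [Set.mem_preimage, Set.mem_prod, Set.mem_univ, and_true]
    rw [hproj z]
  constructor
  · intro B
    rw [ProbabilityMeasure.map_apply _ _ ((hℬ_mble B B.2).prod MeasurableSet.univ), hpre]
    exact hμ.1 B
  · intro A B C hA hAB hBC
    rw [ProbabilityMeasure.map_apply _ _ hA,
      ProbabilityMeasure.map_apply _ _ ((hℬ_mble B B.2).prod MeasurableSet.univ),
      ProbabilityMeasure.map_apply _ _ hA, hpre]
    refine hμ.2 (f ⁻¹' A) B C (hf hA) ?_ ?_
    · intro z hz
      have : f z ∈ (B : Set X) ×ˢ (Set.univ : Set Y') := hAB hz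
      rw [← hpre]
      exact this
    · rintro ⟨x, y⟩ ⟨hx, -⟩
      refine ⟨?_, Set.mem_univ _⟩
      by_cases hY' : Nonempty Y'
      · obtain ⟨y'⟩ := hY'
        exact (hBC (⟨hx, Set.mem_univ y'⟩ : (x, y') ∈ (B : Set X) ×ˢ Set.univ)).1
      · exact absurd ⟨(f (x, y)).2⟩ hY'

/-- Let `(X, Σ_X, ℬ)` be a conditional measurable space (`ℬ` a countable
family of nonempty measurable sets), `Y`, `Y'` measurable spaces, `Z := X × Y`,
`Z' := X × Y'` with product σ-algebras and conditioning events `ℬ_Z := {B × Y : B ∈ ℬ}`,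
`ℬ_{Z'} := {B × Y' : B ∈ ℬ}`.  If `f : Z → Z'` is measurable and preserves the
`X`-coordinate, then the image-measure map with conditioning events
`f̂ : Δ^ℬ(Z) → Δ^ℬ(Z')`, `f̂(μ)_{B×Y'}(E) = μ_{B×Y}(f⁻¹(E))`, is measurable with respect
to `Σ_{ℬ(Z)}` and `Σ_{ℬ(Z')}`. -/
theorem pushforward_cps_measurable {X Y Y' : Type*} [MeasurableSpace X] [MeasurableSpace Y]
    [MeasurableSpace Y'] (ℬ : Set (Set X)) (hℬ_count : ℬ.Countable)
    (hℬ_mble : ∀ B ∈ ℬ, MeasurableSet B) (hℬ_ne : ∀ B ∈ ℬ, B.Nonempty)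
    (f : X × Y → X × Y') (hf : Measurable f) (hproj : ∀ z, (f z).1 = z.1) :
    @Measurable (ProdCPS X Y ℬ) (ProdCPS X Y' ℬ)
      (MeasurableSpace.generateFrom
        {s : Set (ProdCPS X Y ℬ) |
          ∃ A : Set (X × Y), MeasurableSet A ∧ ∃ B : ↥ℬ, ∃ p : ℝ, p ∈ Set.Icc (0 : ℝ) 1 ∧
            s = {μ : ProdCPS X Y ℬ | p ≤ (μ.1 B A : ℝ)}})
      (MeasurableSpace.generateFrom
        {s : Set (ProdCPS X Y' ℬ) |
          ∃ A : Set (X × Y'), MeasurableSet A ∧ ∃ B : ↥ℬ, ∃ p : ℝ, p ∈ Set.Icc (0 : ℝ) 1 ∧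
            s = {μ : ProdCPS X Y' ℬ | p ≤ (μ.1 B A : ℝ)}})
      (fun μ : ProdCPS X Y ℬ =>
        (⟨fun B : ↥ℬ => (μ.1 B).map hf.aemeasurable,
          isProdCPS_map ℬ hℬ_mble hℬ_ne f hf hproj μ.1 μ.2⟩ : ProdCPS X Y' ℬ)) := by
  refine @measurable_generateFrom _ _ (_) _ _ ?_
  rintro _ ⟨A, hA, B, p, hp, rfl⟩
  refine MeasurableSpace.measurableSet_generateFrom ⟨f ⁻¹' A, hf hA, B, p, hp, ?_⟩
  ext μ
  change p ≤ ((μ.1 B).map hf.aemeasurable A : ℝ) ↔ p ≤ (μ.1 B (f ⁻¹' A) : ℝ)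
  rw [ProbabilityMeasure.map_apply _ _ hA]
end
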